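/- Let n be even and n/2 + 1 ≤ p ≤ n−2. Set r' = Σ_{i=0}^{p−n/2} C(n,i) + C(n−1, p−n/2) and s' = C(p−1, p−n/2). Then |C^p(I_{r'−s'+1})| < 2^{n−1} − (r' − 2s' + 1). -/

import Mathlib

open Finset

/-- Strict simplicial order on subsets of `[n]` (as `Finset (Fin n)`):
`x` precedes `y` iff `|x| < |y|`, or `|x| = |y|` and `min (x ∆ y) ∈ x`. -/
def SimpLT {n : ℕ} (x y : Finset (Fin n)) : Prop :=
  x.card < y.card ∨
    (x.card = y.card ∧ ∃ i, i ∈ x ∧ i ∉ y ∧ ∀ j ∈ symmDiff x y, i ≤ j)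

instance {n : ℕ} (x y : Finset (Fin n)) : Decidable (SimpLT x y) := by
  unfold SimpLT; infer_instance

/-- `ISeg n m` : the initial segment consisting of the first `m` subsets of `[n]`
in the simplicial ordering (the sets having fewer than `m` strict predecessors). -/
def ISeg (n m : ℕ) : Finset (Finset (Fin n)) :=
  Finset.univ.filter fun x => (Finset.univ.filter fun z => SimpLT z x).card < m

/-- `Cball n p A` : the set `C^p[A]` of all subsets of `[n]` at symmetric-difference
distance at most `p` from every member of `A`. -/
def Cball (n p : ℕ) (A : Finset (Finset (Fin n))) : Finset (Finset (Fin n)) :=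
  Finset.univ.filter fun y => ∀ x ∈ A, (symmDiff x y).card ≤ p

/-- `Cpunct n p A` : the set `C^p(A) = C^p[A] \ A`. -/
def Cpunct (n p : ℕ) (A : Finset (Finset (Fin n))) : Finset (Finset (Fin n)) :=
  Cball n p A \ A

/-- The `p`-th power of the hypercube `Q_n`: vertices are subsets of `[n]`,
adjacent iff the symmetric difference has size between `1` and `p`. -/
def cubePow (n p : ℕ) : SimpleGraph (Finset (Fin n)) where
  Adj x y := 1 ≤ (symmDiff x y).card ∧ (symmDiff x y).card ≤ p
  symm := ⟨fun x y h => by simpa [symmDiff_comm] using h⟩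
  loopless := ⟨fun x h => by simp [symmDiff_self] at h⟩

/-- `G` admits a b-coloring with `k` colors: a proper coloring with colors `Fin k`
such that every color class contains a vertex having a neighbor in each other
color class. -/
def HasBColoring {V : Type*} (G : SimpleGraph V) (k : ℕ) : Prop :=
  ∃ c : V → Fin k,
    (∀ x y, G.Adj x y → c x ≠ c y) ∧
    (∀ i : Fin k, ∃ v, c v = i ∧ ∀ j : Fin k, j ≠ i → ∃ w, G.Adj v w ∧ c w = j)

/-- The `p`-th power of the Hamming graph `H_{n,q}`: vertices are `q`-ary `n`-tuples,
adjacent iff their Hamming distance is between `1` and `p`. -/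
def hammingPow (n q p : ℕ) : SimpleGraph (Fin n → ZMod q) where
  Adj x y := 1 ≤ hammingDist x y ∧ hammingDist x y ≤ p
  symm := ⟨fun x y h => by simpa [hammingDist_comm] using h⟩
  loopless := ⟨fun x h => by simp at h⟩


/-- The sets `S ∪ w` with `w` a `k`-subset of `T`, for disjoint `S` and `T`. -/
def betweenCard {α : Type*} [Fintype α] [DecidableEq α] (S T : Finset α) (k : ℕ) :
    Finset (Finset α) :=
  univ.filter fun x => S ⊆ x ∧ x ⊆ S ∪ T ∧ #x = #S + k

theorem mem_betweenCard {α : Type*} [Fintype α] [DecidableEq α] {S T x : Finset α} {k : ℕ} :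
    x ∈ betweenCard S T k ↔ S ⊆ x ∧ x ⊆ S ∪ T ∧ #x = #S + k := by
  simp [betweenCard]

theorem card_betweenCard {α : Type*} [Fintype α] [DecidableEq α] {S T : Finset α}
    (h : Disjoint S T) (k : ℕ) : #(betweenCard S T k) = (#T).choose k := by
  rw [← card_powersetCard]
  refine card_bij' (fun x _ => x \ S) (fun w _ => S ∪ w) ?_ ?_ ?_ ?_
  · intro x hx
    obtain ⟨h1, h2, h3⟩ := mem_betweenCard.1 hx
    refine mem_powersetCard.2 ⟨?_, ?_⟩
    · exact sdiff_le_iff.2 h2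
    · rw [card_sdiff_of_subset h1]; omega
  · intro w hw
    obtain ⟨h1, h2⟩ := mem_powersetCard.1 hw
    refine mem_betweenCard.2 ⟨subset_union_left, union_subset_union_right h1, ?_⟩
    rw [card_union_of_disjoint (disjoint_of_subset_right h1 h), h2]
  · intro x hx
    exact union_sdiff_of_subset (mem_betweenCard.1 hx).1
  · intro w hw
    exact union_sdiff_cancel_left
      (disjoint_of_subset_right (mem_powersetCard.1 hw).1 h)

theorem card_filter_card_le {α : Type*} [Fintype α] [DecidableEq α] (k : ℕ) :
    #(univ.filter fun x : Finset α => #x ≤ k)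
      = ∑ i ∈ range (k + 1), (Fintype.card α).choose i := by
  have : (univ.filter fun x : Finset α => #x ≤ k)
      = (range (k + 1)).biUnion fun i => powersetCard i univ := by
    ext x; simp [mem_powersetCard]
  rw [this, card_biUnion]
  · simp
  · exact fun i _ j _ hij => pairwise_disjoint_powersetCard univ hij

/-- Exactly half of the subsets of a `2m`-set have size `< m`, or size `m` and contain a
given point. -/
theorem two_mul_card_lower_half {α : Type*} [Fintype α] [DecidableEq α] {m : ℕ}
    (hm : Fintype.card α = 2 * m) (a : α) :
    2 * #(univ.filter fun x : Finset α => #x < m ∨ #x = m ∧ a ∈ x) = 2 ^ (2 * m) := by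
  have h : #(univ.filter fun x : Finset α => #x < m ∨ #x = m ∧ a ∈ x)
      = #(univ.filter fun x : Finset α => ¬ (#x < m ∨ #x = m ∧ a ∈ x)) := by
    refine card_bij' (fun x _ => xᶜ) (fun x _ => xᶜ) ?_ ?_ ?_ ?_
    · intro x hx
      have h := card_add_card_compl x
      rw [hm] at h
      simp only [mem_filter, mem_univ, true_and, mem_compl] at hx ⊢
      by_cases ha : a ∈ x <;> simp only [ha, and_true, and_false, not_true, not_false_eq_true,
        or_false] at hx ⊢ <;> omega
    · intro x hx
      have h := card_add_card_compl x
      rw [hm] at h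
      simp only [mem_filter, mem_univ, true_and, mem_compl] at hx ⊢
      by_cases ha : a ∈ x <;> simp only [ha, and_true, and_false, not_true, not_false_eq_true,
        or_false] at hx ⊢ <;> omega
    · simp
    · simp
  have h2 := card_filter_add_card_filter_not (s := (univ : Finset (Finset α)))
    (fun x : Finset α => #x < m ∨ #x = m ∧ a ∈ x)
  rw [← h, card_univ, Fintype.card_finset, hm] at h2
  omega

theorem SimpLT.irrefl {n : ℕ} (x : Finset (Fin n)) : ¬ SimpLT x x := by
  rintro (h | ⟨-, i, h1, h2, -⟩)
  · exact lt_irrefl _ h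
  · exact h2 h1

/-- A down-closed family for the simplicial order is contained in the initial segment of the
same size. -/
theorem subset_ISeg {n : ℕ} {J : Finset (Finset (Fin n))}
    (hJ : ∀ x ∈ J, ∀ z, SimpLT z x → z ∈ J) : J ⊆ ISeg n #J := by
  intro x hx
  simp only [ISeg, mem_filter, mem_univ, true_and]
  refine card_lt_card ((ssubset_iff_of_subset ?_).2 ⟨x, hx, ?_⟩)
  · intro z hz
    exact hJ x hx z (mem_filter.1 hz).2
  · simpa using SimpLT.irrefl x

theorem Cpunct_anti {n p : ℕ} {A B : Finset (Finset (Fin n))} (h : A ⊆ B) :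
    Cpunct n p B ⊆ Cpunct n p A := by
  refine sdiff_subset_sdiff (fun y hy => ?_) h
  simp only [Cball, mem_filter, mem_univ, true_and] at hy ⊢
  exact fun x hx => hy x (h hx)

theorem card_symmDiff_of_disjoint {α : Type*} [DecidableEq α] {x y : Finset α}
    (h : Disjoint x y) : #(symmDiff x y) = #x + #y := by
  rw [h.symmDiff_eq_sup, sup_eq_union, card_union_of_disjoint h]

/-- The family of all sets of size at most `k`, all `(k+1)`-sets containing `o` and some
element of `(o, c]`, and the set `{o} ∪ (c, d]`. -/
def segFamily {n : ℕ} (k : ℕ) (o c d : Fin n) : Finset (Finset (Fin n)) :=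
  insert (insert o (Ioc c d))
    ((univ.filter fun x => #x ≤ k) ∪
      (betweenCard {o} (Ioi o) k \ betweenCard {o} (Ioi c) k))

theorem mem_segFamily {n k : ℕ} {o c d : Fin n} (ho : ∀ i, o ≤ i) {x : Finset (Fin n)} :
    x ∈ segFamily k o c d ↔ x = insert o (Ioc c d) ∨ #x ≤ k ∨
      (#x = k + 1 ∧ o ∈ x ∧ ∃ i ∈ x, o < i ∧ i ≤ c) := by
  have hsub : x ⊆ {o} ∪ Ioi o := by
    intro i _
    rcases (ho i).eq_or_lt with rfl | h
    · simp
    · exact mem_union_right _ (mem_Ioi.2 h)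
  have hc : ¬ x ⊆ {o} ∪ Ioi c ↔ ∃ i ∈ x, o < i ∧ i ≤ c := by
    simp only [subset_iff, mem_union, mem_singleton, mem_Ioi, not_forall, not_or, not_lt,
      exists_prop]
    refine exists_congr fun i => and_congr_right fun _ => and_congr_left fun _ => ?_
    exact ⟨fun h => lt_of_le_of_ne (ho i) (Ne.symm h), fun h => h.ne'⟩
  simp only [segFamily, mem_insert, mem_union, mem_filter, mem_univ, true_and, mem_sdiff,
    mem_betweenCard, singleton_subset_iff, card_singleton, hsub, ← hc]
  rw [add_comm 1 k]
  tauto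

theorem card_insert_Ioc {n k : ℕ} {o c d : Fin n} (hoc : o < c) (hd : d.val = c.val + k) :
    #(insert o (Ioc c d)) = k + 1 := by
  rw [card_insert_of_notMem, Fin.card_Ioc]
  · omega
  · simp [hoc.le]

theorem card_segFamily {n k : ℕ} {o c d : Fin n} (ho : o.val = 0) (hoc : o < c)
    (hd : d.val = c.val + k) :
    #(segFamily k o c d) + (n - 1 - c).choose k
      = ∑ i ∈ range (k + 1), n.choose i + (n - 1).choose k + 1 := by
  have hsub : betweenCard {o} (Ioi c) k ⊆ betweenCard {o} (Ioi o) k := by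
    intro x hx
    obtain ⟨h1, h2, h3⟩ := mem_betweenCard.1 hx
    exact mem_betweenCard.2 ⟨h1, h2.trans (union_subset_union_right
      (Ioi_subset_Ioi hoc.le)), h3⟩
  have hle := card_le_card hsub
  rw [segFamily, card_insert_of_notMem, card_union_of_disjoint, card_filter_card_le,
    card_sdiff_of_subset hsub]
  · have hc : Disjoint {o} (Ioi c) := by simp [hoc.le]
    have ho' : Disjoint {o} (Ioi o) := by simp
    rw [card_betweenCard hc, card_betweenCard ho'] at hle ⊢
    simp only [Fin.card_Ioi, Fintype.card_fin, ho, Nat.sub_zero] at *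
    omega
  · rw [disjoint_left]
    intro x hx hx'
    have h1 := (mem_betweenCard.1 (mem_sdiff.1 hx').1).2.2
    have h2 := (mem_filter.1 hx).2
    rw [card_singleton] at h1
    omega
  · have hcard := card_insert_Ioc hoc hd
    simp only [mem_union, mem_filter, mem_univ, true_and, mem_sdiff, not_or, not_and, not_not]
    refine ⟨by omega, fun _ => mem_betweenCard.2 ⟨by simp, ?_, by simp [hcard, add_comm]⟩⟩
    intro i
    simp only [mem_insert, mem_Ioc, mem_union, mem_singleton, mem_Ioi]
    tauto

theorem segFamily_downClosed {n k : ℕ} {o c d : Fin n} (ho : ∀ i, o ≤ i) (hoc : o < c)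
    (hd : d.val = c.val + k) :
    ∀ x ∈ segFamily k o c d, ∀ z, SimpLT z x → z ∈ segFamily k o c d := by
  intro x hx z hz
  rw [mem_segFamily ho] at hx ⊢
  have hcard := card_insert_Ioc hoc hd
  have hx' : #x ≤ k ∨ #x = k + 1 ∧ o ∈ x := by
    rcases hx with rfl | h | h
    · exact Or.inr ⟨hcard, mem_insert_self _ _⟩
    · exact Or.inl h
    · exact Or.inr ⟨h.1, h.2.1⟩
  rcases hz with hz | ⟨hz, i, hiz, hix, hmin⟩
  · right; left; omega
  rcases hx' with hx' | ⟨hxc, hox⟩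
  · right; left; omega
  have hio : o < i := lt_of_le_of_ne (ho i) fun h => hix (h ▸ hox)
  have hlt : ∀ j ∈ x, j < i → j ∈ z := by
    intro j hj hji
    by_contra hjz
    exact absurd (hmin j (mem_symmDiff.2 (Or.inr ⟨hj, hjz⟩))) (not_le.2 hji)
  have hoz : o ∈ z := hlt o hox hio
  by_cases hic : i ≤ c
  · exact Or.inr (Or.inr ⟨by omega, hoz, i, hiz, hio, hic⟩)
  rw [not_le] at hic
  rcases hx with rfl | h | ⟨-, -, j, hjx, hoj, hjc⟩
  · have hdi : d < i := by
      by_contra h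
      exact hix (mem_insert_of_mem (mem_Ioc.2 ⟨hic, not_lt.1 h⟩))
    left
    refine (eq_of_subset_of_card_le (fun j hj => hlt j hj ?_) hz.le).symm
    rcases mem_insert.1 hj with rfl | hj'
    · exact hio
    · exact (mem_Ioc.1 hj').2.trans_lt hdi
  · omega
  · exact Or.inr (Or.inr ⟨by omega, hoz, j, hlt j hjx (hjc.trans_lt hic), hoj, hjc⟩)

theorem segFamily_subset_Cball {n k p : ℕ} {o c d : Fin n} (ho : ∀ i, o ≤ i) (hoc : o < c)
    (hd : d.val = c.val + k) (hk : 2 * (k + 1) ≤ p) :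
    segFamily k o c d ⊆ Cball n p (segFamily k o c d) := by
  have hle : ∀ x ∈ segFamily k o c d, #x ≤ k + 1 := by
    intro x hx
    rcases (mem_segFamily ho).1 hx with rfl | h | h
    · exact (card_insert_Ioc hoc hd).le
    · omega
    · exact h.1.le
  intro y hy
  simp only [Cball, mem_filter, mem_univ, true_and]
  intro x hx
  have h1 : #(symmDiff x y) ≤ #(x ∪ y) := card_le_card symmDiff_subset_union
  have h2 := card_union_le x y
  have h3 := hle x hx
  have h4 := hle y hy
  omega

theorem card_le_of_mem_Cball {n k m : ℕ} {A : Finset (Finset (Fin n))} (hn : m + k < n)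
    (hA : ∀ x, #x ≤ k → x ∈ A) {y : Finset (Fin n)} (hy : y ∈ Cball n (m + k) A) :
    #y ≤ m := by
  simp only [Cball, mem_filter, mem_univ, true_and] at hy
  obtain ⟨x, hx, hxc⟩ := exists_subset_card_eq (min_le_right k #yᶜ)
  have h1 := hy x (hA x (by omega))
  rw [card_symmDiff_of_disjoint (subset_compl_iff_disjoint_right.1 hx), hxc] at h1
  have h2 := card_add_card_compl y
  rw [Fintype.card_fin] at h2
  omega

theorem Cball_segFamily_subset {m k : ℕ} {o c d e : Fin (2 * m)} (ho : ∀ i, o ≤ i)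
    (hoc : o < c) (hd : d.val = c.val + k) (hde : d ≤ e) (hk : 1 ≤ k) (hkm : k < m)
    (hc : c.val + k = m) :
    Cball (2 * m) (m + k) (segFamily k o c d) ⊆
      (univ.filter fun y => #y < m ∨ #y = m ∧ o ∈ y) ∪
        (betweenCard (Ioc o c) (Ioi c) k).erase (Ioc o c ∪ Ioi e) := by
  intro y hy
  have hym := card_le_of_mem_Cball (by omega)
    (fun x hx => (mem_segFamily ho).2 (Or.inr (Or.inl hx))) hy
  by_cases hlow : #y < m ∨ #y = m ∧ o ∈ y
  · exact mem_union_left _ (mem_filter.2 ⟨mem_univ _, hlow⟩)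
  have hcard : #y = m := by omega
  have hoy : o ∉ y := fun h => hlow (Or.inr ⟨hcard, h⟩)
  simp only [Cball, mem_filter, mem_univ, true_and] at hy
  have hmeet : ∀ x ∈ segFamily k o c d, #x = k + 1 → ¬ Disjoint x y := by
    intro x hx hxc hdisj
    have := hy x hx
    rw [card_symmDiff_of_disjoint hdisj] at this
    omega
  have ho0 : o.val = 0 := by
    have : o ≤ (⟨0, by omega⟩ : Fin (2 * m)) := ho _
    exact Nat.le_zero.1 this
  refine mem_union_right _ (mem_erase.2 ⟨?_, mem_betweenCard.2 ⟨?_, ?_, ?_⟩⟩)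
  · rintro rfl
    refine hmeet _ ((mem_segFamily ho).2 (Or.inl rfl)) (card_insert_Ioc hoc hd) ?_
    rw [disjoint_left]
    intro i hi hi'
    simp only [mem_insert, mem_Ioc, mem_union, mem_Ioi] at hi hi'
    rcases hi with rfl | hi <;> omega
  · intro i hi
    by_contra hiy
    obtain ⟨hoi, hic⟩ := mem_Ioc.1 hi
    have hyc := card_add_card_compl y
    rw [Fintype.card_fin] at hyc
    have hpair : #({o, i} : Finset (Fin (2 * m))) = 2 := card_pair hoi.ne
    obtain ⟨x, hx1, hx2, hx3⟩ := exists_subsuperset_card_eq (s := {o, i}) (t := yᶜ) (n := k + 1)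
      (by simp [insert_subset_iff, hoy, hiy]) (by omega) (by omega)
    refine hmeet x ((mem_segFamily ho).2 (Or.inr (Or.inr ⟨hx3, hx1 (by simp), i,
      hx1 (by simp), hoi, hic⟩))) hx3 (subset_compl_iff_disjoint_right.1 hx2)
  · intro i hi
    have hio : o < i := lt_of_le_of_ne (ho i) fun h => hoy (h ▸ hi)
    simp only [mem_union, mem_Ioc, mem_Ioi]
    rcases le_or_gt i c with h | h <;> tauto
  · rw [Fin.card_Ioc]; omega

theorem card_Cball_segFamily_lt {m k : ℕ} {o c d e : Fin (2 * m)} (ho : ∀ i, o ≤ i)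
    (hoc : o < c) (hd : d.val = c.val + k) (hde : d ≤ e) (hk : 1 ≤ k)
    (hkm : k < m) (hc : c.val + k = m) (he : e.val + k + 1 = 2 * m) :
    #(Cball (2 * m) (m + k) (segFamily k o c d))
      < 2 ^ (2 * m - 1) + (2 * m - 1 - c.val).choose k := by
  have h1 := (card_le_card (Cball_segFamily_subset ho hoc hd hde hk hkm hc)).trans
    (card_union_le _ _)
  have h2 := two_mul_card_lower_half (Fintype.card_fin (2 * m)) o
  have hmem : Ioc o c ∪ Ioi e ∈ betweenCard (Ioc o c) (Ioi c) k := by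
    have hce : c ≤ e := le_trans (by rw [Fin.le_def]; omega) hde
    refine mem_betweenCard.2 ⟨subset_union_left,
      union_subset_union_right (Ioi_subset_Ioi hce), ?_⟩
    rw [card_union_of_disjoint, Fin.card_Ioi]
    · omega
    · rw [disjoint_left]
      intro i hi hi'
      exact absurd ((mem_Ioc.1 hi).2.trans hce) (not_le.2 (mem_Ioi.1 hi'))
  have h3 := card_erase_lt_of_mem hmem
  rw [card_betweenCard, Fin.card_Ioi] at h3
  · have h4 : 2 ^ (2 * m) = 2 * 2 ^ (2 * m - 1) := by
      rw [← pow_succ']; congr 1; omega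
    omega
  · rw [disjoint_left]
    intro i hi hi'
    exact absurd (mem_Ioc.1 hi).2 (not_le.2 (mem_Ioi.1 hi'))

/-- For even `n` and `n/2 + 1 ≤ p ≤ n-2`, with `r' = ∑_{i=0}^{p-n/2} C(n,i) + C(n-1, p-n/2)`
and `s' = C(p-1, p-n/2)`, we have `|C^p(I_{r'-s'+1})| < 2^{n-1} - (r' - 2s' + 1)`. -/
theorem stmt6 (n p : ℕ) (heven : Even n) (hp1 : n / 2 + 1 ≤ p) (hp2 : p ≤ n - 2)
    (r' s' : ℕ)
    (hr : r' = (∑ i ∈ Finset.range (p - n / 2 + 1), Nat.choose n i)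
            + Nat.choose (n - 1) (p - n / 2))
    (hs : s' = Nat.choose (p - 1) (p - n / 2)) :
    ((Cpunct n p (ISeg n (r' - s' + 1))).card : ℤ)
      < 2 ^ (n - 1) - ((r' : ℤ) - 2 * (s' : ℤ) + 1) := by
  obtain ⟨m, rfl⟩ := heven.exists_two_nsmul
  rw [smul_eq_mul] at *
  obtain ⟨k, rfl⟩ : ∃ k, p = m + k := ⟨p - m, by omega⟩
  have hk : m + k - 2 * m / 2 = k := by omega
  rw [hk] at hr hs
  have hk1 : 1 ≤ k := by omega
  have hkm : k + 2 ≤ m := by omega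
  let o : Fin (2 * m) := ⟨0, by omega⟩
  let c : Fin (2 * m) := ⟨m - k, by omega⟩
  let d : Fin (2 * m) := ⟨m, by omega⟩
  let e : Fin (2 * m) := ⟨2 * m - k - 1, by omega⟩
  have ho : ∀ i, o ≤ i := fun i => Nat.zero_le _
  have hoc : o < c := by rw [Fin.lt_def]; simp only [o, c]; omega
  have hd : d.val = c.val + k := by simp only [c, d]; omega
  have hde : d ≤ e := by rw [Fin.le_def]; simp only [d, e]; omega
  have hball := card_Cball_segFamily_lt ho hoc hd hde hk1 (by omega)
    (by simp only [c]; omega) (by simp only [e]; omega)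
  have hcard := card_segFamily (k := k) rfl hoc hd
  have hcs : (2 * m - 1 - c.val).choose k = s' := by
    rw [hs]; congr 1; simp only [c]; omega
  rw [hcs] at hball hcard
  rw [← hr] at hcard
  have hsr : s' ≤ r' := by
    rw [hs, hr]
    exact (Nat.choose_le_choose k (by omega)).trans (Nat.le_add_left _ _)
  have hsize : #(segFamily k o c d) = r' - s' + 1 := by omega
  have hseg := subset_ISeg (segFamily_downClosed ho hoc hd)
  rw [hsize] at hseg
  have h1 := card_le_card (Cpunct_anti (p := m + k) hseg)
  have h2 : #(Cpunct (2 * m) (m + k) (segFamily k o c d)) = _ :=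
    card_sdiff_of_subset (segFamily_subset_Cball ho hoc hd (by omega))
  have h3 := card_le_card (segFamily_subset_Cball (p := m + k) ho hoc hd (by omega))
  zify at h1 hball hcard h2 h3
  rw [Nat.cast_sub (by exact_mod_cast h3)] at h2
  linarith
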